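/- arXiv:2403.17962 — 2 statements merged into one kernel-verified Lean document; each statement's English description precedes it below -/
import Mathlib

section
/- Let A be an n×n X-matrix over a field K. If n is even, then det A = ∏_{i=1}^{n/2} (a_{i,i} a_{n−i+1,n−i+1} − a_{i,n−i+1} a_{n−i+1,i}). If n is odd, then det A = a_{(n+1)/2,(n+1)/2} · ∏_{i=1}^{(n−1)/2} (a_{i,i} a_{n−i+1,n−i+1} − a_{i,n−i+1} a_{n−i+1,i}). -/
open Matrix

/-- An `n × n` matrix is an X-matrix if every entry off the diagonal and off the
anti-diagonal (1-based: `i ≠ j` and `i + j ≠ n + 1`) vanishes. -/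
def IsXMatrix {n : ℕ} {K : Type*} [Zero K] (A : Matrix (Fin n) (Fin n) K) : Prop :=
  ∀ i j : Fin n, i ≠ j → j ≠ i.rev → A i j = 0

/-- The inclusion of the first half of the indices, `Fin (n / 2) → Fin n`
(1-based: `i = 1, …, ⌊n/2⌋`). -/
def lowEmb (n : ℕ) : Fin (n / 2) → Fin n := Fin.castLE (Nat.div_le_self n 2)

/-- The reindexing map pairing `i` with `i.rev`, plus the centre when `n` is odd. -/
def xMap (n : ℕ) : (Fin 2 × Fin (n / 2)) ⊕ Fin (n % 2) → Fin n
  | .inl (a, k) => if a = 0 then lowEmb n k else (lowEmb n k).rev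
  | .inr j => ⟨n / 2, by have := j.2; omega⟩

lemma xMap_injective (n : ℕ) : Function.Injective (xMap n) := by
  rintro (⟨a, k⟩ | j) (⟨b, l⟩ | j') h
  · have hk := k.2
    have hl := l.2
    fin_cases a <;> fin_cases b <;>
      simp [xMap, lowEmb, Fin.ext_iff, Fin.val_rev] at h ⊢ <;> omega
  · have hk := k.2
    have hl := j'.2
    fin_cases a <;> simp [xMap, lowEmb, Fin.ext_iff, Fin.val_rev] at h <;> omega
  · have hk := l.2
    have hl := j.2
    fin_cases b <;> simp [xMap, lowEmb, Fin.ext_iff, Fin.val_rev] at h <;> omega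
  · have hk := j.2
    have hl := j'.2
    congr 1
    ext
    omega

lemma xMap_bijective (n : ℕ) : Function.Bijective (xMap n) := by
  rw [Fintype.bijective_iff_injective_and_card]
  refine ⟨xMap_injective n, ?_⟩
  simp
  omega

lemma xMap_rev_inl (n : ℕ) (a : Fin 2) (k : Fin (n / 2)) :
    (xMap n (.inl (a, k))).rev = xMap n (.inl (1 - a, k)) := by
  fin_cases a <;> simp [xMap]

lemma xMap_rev_inr (n : ℕ) (j : Fin (n % 2)) :
    (xMap n (.inr j)).rev = xMap n (.inr j) := by
  have := j.2
  simp [xMap, Fin.ext_iff, Fin.val_rev]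
  omega

lemma det_xMatrix_aux {n : ℕ} {K : Type*} [Field K]
    (A : Matrix (Fin n) (Fin n) K) (hA : IsXMatrix A) :
    A.det = (∏ i : Fin (n / 2),
      (A (lowEmb n i) (lowEmb n i) * A (lowEmb n i).rev (lowEmb n i).rev -
        A (lowEmb n i) (lowEmb n i).rev * A (lowEmb n i).rev (lowEmb n i))) *
      (Matrix.of fun i j : Fin (n % 2) => A (xMap n (.inr i)) (xMap n (.inr j))).det := by
  have hz : ∀ x y, x ≠ y → xMap n y ≠ (xMap n x).rev → A (xMap n x) (xMap n y) = 0 :=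
    fun x y h h' => hA _ _ ((xMap_injective n).ne h) h'
  have key : A.submatrix (xMap n) (xMap n) =
      Matrix.fromBlocks
        (Matrix.blockDiagonal fun k : Fin (n / 2) =>
          Matrix.of fun a b : Fin 2 => A (xMap n (.inl (a, k))) (xMap n (.inl (b, k))))
        0 0 (Matrix.of fun i j : Fin (n % 2) => A (xMap n (.inr i)) (xMap n (.inr j))) := by
    ext (⟨a, k⟩ | j) (⟨b, l⟩ | j')
    · simp only [Matrix.submatrix_apply, Matrix.fromBlocks_apply₁₁, Matrix.blockDiagonal_apply]
      split_ifs with h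
      · subst h
        rfl
      · apply hz
        · intro h'
          simp at h'
          exact h h'.2
        · rw [xMap_rev_inl]
          refine (xMap_injective n).ne ?_
          intro h'
          simp at h'
          exact h h'.2.symm
    · apply hz
      · simp
      · rw [xMap_rev_inl]
        exact (xMap_injective n).ne (by simp)
    · apply hz
      · simp
      · rw [xMap_rev_inr]
        exact (xMap_injective n).ne (by simp)
    · rfl
  have h1 : A.det = (A.submatrix (xMap n) (xMap n)).det :=
    (Matrix.det_submatrix_equiv_self (Equiv.ofBijective _ (xMap_bijective n)) A).symm
  rw [h1, key, Matrix.det_fromBlocks_zero₂₁, Matrix.det_blockDiagonal]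
  congr 1
  refine Finset.prod_congr rfl fun k _ => ?_
  rw [Matrix.det_fin_two]
  simp [xMap]

lemma det_const_one {K : Type*} [Field K] (c : K) (r : ℕ) (hr : r = 1) :
    (Matrix.of fun _ _ : Fin r => c).det = c := by
  subst hr
  simp

lemma det_size_zero {K : Type*} [Field K] (r : ℕ) (hr : r = 0)
    (M : Matrix (Fin r) (Fin r) K) : M.det = 1 := by
  subst hr
  simp

/-- The determinant of an X-matrix is the product of the determinants of its inner
`2 × 2` submatrices on rows/columns `i` and `n - i + 1` (1-based), times the central
entry `a_{(n+1)/2,(n+1)/2}` when `n` is odd. -/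
theorem det_xMatrix {n : ℕ} {K : Type*} [Field K]
    (A : Matrix (Fin n) (Fin n) K) (hA : IsXMatrix A) :
    (Even n → A.det = ∏ i : Fin (n / 2),
      (A (lowEmb n i) (lowEmb n i) * A (lowEmb n i).rev (lowEmb n i).rev -
        A (lowEmb n i) (lowEmb n i).rev * A (lowEmb n i).rev (lowEmb n i))) ∧
    (∀ h : Odd n, A.det =
      (∏ i : Fin (n / 2),
        (A (lowEmb n i) (lowEmb n i) * A (lowEmb n i).rev (lowEmb n i).rev -
          A (lowEmb n i) (lowEmb n i).rev * A (lowEmb n i).rev (lowEmb n i))) *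
      A ⟨n / 2, by rcases h with ⟨k, rfl⟩; omega⟩ ⟨n / 2, by rcases h with ⟨k, rfl⟩; omega⟩) := by
  constructor
  · intro h
    rw [det_xMatrix_aux A hA, det_size_zero _ (Nat.even_iff.mp h), mul_one]
  · intro h
    rw [det_xMatrix_aux A hA]
    refine congrArg _ ?_
    have hlt : n / 2 < n := by
      have := h.pos
      omega
    exact det_const_one (A ⟨n / 2, hlt⟩ ⟨n / 2, hlt⟩) _ (Nat.odd_iff.mp h)
end

section
/- Let A be an n×n X-matrix over a field K and let χ_A(t) = det(tI − A) be its characteristic polynomial. If n is even, then χ_A(t) = ∏_{i=1}^{n/2} [(t − a_{i,i})(t − a_{n−i+1,n−i+1}) − a_{i,n−i+1} a_{n−i+1,i}]. If n is odd, then χ_A(t) = (t − a_{(n+1)/2,(n+1)/2}) · ∏_{i=1}^{(n−1)/2} [(t − a_{i,i})(t − a_{n−i+1,n−i+1}) − a_{i,n−i+1} a_{n−i+1,i}]. -/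
open Matrix Polynomial

/-- Pairs `(s, i)` are sent to `i` or to its mirror image. -/
def xIdx (n : ℕ) (p : Fin 2 × Fin (n / 2)) : Fin n :=
  if p.1 = 0 then lowEmb n p.2 else (lowEmb n p.2).rev

lemma xIdx_val (n : ℕ) (p : Fin 2 × Fin (n / 2)) :
    (xIdx n p : ℕ) = if p.1 = 0 then (p.2 : ℕ) else n - (p.2 + 1) := by
  unfold xIdx lowEmb
  split_ifs <;> simp [Fin.val_rev]

lemma xIdx_inj (n : ℕ) : Function.Injective (xIdx n) := by
  rintro ⟨s, i⟩ ⟨t, j⟩ h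
  have h' := congrArg Fin.val h
  rw [xIdx_val, xIdx_val] at h'
  have hi := i.2
  have hj := j.2
  fin_cases s <;> fin_cases t <;> simp at h' ⊢ <;> omega

/-- The 2 by 2 block at `k`. -/
def xBlock {n : ℕ} {R : Type*} (B : Matrix (Fin n) (Fin n) R) (k : Fin (n / 2)) :
    Matrix (Fin 2) (Fin 2) R :=
  !![B (lowEmb n k) (lowEmb n k), B (lowEmb n k) (lowEmb n k).rev;
     B (lowEmb n k).rev (lowEmb n k), B (lowEmb n k).rev (lowEmb n k).rev]

lemma xMatrix_submatrix {n : ℕ} {R : Type*} [CommRing R]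
    (B : Matrix (Fin n) (Fin n) R) (hB : IsXMatrix B) :
    B.submatrix (xIdx n) (xIdx n) = blockDiagonal (xBlock B) := by
  ext ⟨s, i⟩ ⟨t, j⟩
  rw [blockDiagonal_apply, submatrix_apply]
  split_ifs with h
  · simp only at h
    subst h
    fin_cases s <;> fin_cases t <;> simp [xBlock, xIdx]
  · simp only at h
    have hij : (i : ℕ) ≠ j := fun h' => h (Fin.ext h')
    have hi := i.2
    have hj := j.2
    apply hB
    · intro h'
      exact h (Prod.ext_iff.1 (xIdx_inj n h')).2
    · intro h'
      have h'' := congrArg Fin.val h'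
      rw [Fin.val_rev, xIdx_val, xIdx_val] at h''
      dsimp only at h''
      split_ifs at h'' <;> omega

lemma det_xMatrix_even {n : ℕ} {R : Type*} [CommRing R] (hn : Even n)
    (B : Matrix (Fin n) (Fin n) R) (hB : IsXMatrix B) :
    B.det = ∏ k, (xBlock B k).det := by
  have hb : Function.Bijective (xIdx n) := by
    rw [Fintype.bijective_iff_injective_and_card]
    refine ⟨xIdx_inj n, ?_⟩
    obtain ⟨k, rfl⟩ := hn
    simp
    omega
  rw [← det_blockDiagonal, ← xMatrix_submatrix B hB,
    ← det_submatrix_equiv_self (Equiv.ofBijective _ hb) B]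
  rfl

lemma det_xMatrix_odd {n : ℕ} {R : Type*} [CommRing R] (hn : Odd n)
    (c : Fin n) (hc : (c : ℕ) = n / 2)
    (B : Matrix (Fin n) (Fin n) R) (hB : IsXMatrix B) :
    B.det = B c c * ∏ k, (xBlock B k).det := by
  have hcr : c.rev = c := by
    apply Fin.ext
    rw [Fin.val_rev]
    obtain ⟨k, rfl⟩ := hn
    omega
  have hne : ∀ p, xIdx n p ≠ c := by
    intro p h
    have h' := congrArg Fin.val h
    have hi := p.2.2
    rw [xIdx_val] at h'
    obtain ⟨k, hk⟩ := hn
    split_ifs at h' <;> omega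
  let f : Unit ⊕ (Fin 2 × Fin (n / 2)) → Fin n := Sum.elim (fun _ => c) (xIdx n)
  have hb : Function.Bijective f := by
    rw [Fintype.bijective_iff_injective_and_card]
    constructor
    · rintro (a | a) (b | b) h
      · rfl
      · exact absurd h.symm (hne b)
      · exact absurd h (hne a)
      · exact congrArg Sum.inr (xIdx_inj n h)
    · obtain ⟨k, rfl⟩ := hn
      simp
      omega
  have hs : B.submatrix f f =
      fromBlocks (Matrix.of fun _ _ => B c c : Matrix Unit Unit R) 0 0 (blockDiagonal (xBlock B)) := by
    rw [← xMatrix_submatrix B hB]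
    ext (a | a) (b | b)
    · rfl
    · refine hB _ _ (hne b).symm ?_
      change xIdx n b ≠ c.rev
      rw [hcr]
      exact hne b
    · refine hB _ _ (hne a) ?_
      change c ≠ (xIdx n a).rev
      intro h
      apply hne a
      rw [← hcr, h, Fin.rev_rev]
    · rfl
  rw [← det_submatrix_equiv_self (Equiv.ofBijective _ hb) B]
  change (B.submatrix f f).det = _
  rw [hs, det_fromBlocks_zero₂₁, det_blockDiagonal, det_unique, of_apply]

lemma IsXMatrix.charmatrix {n : ℕ} {K : Type*} [Field K]
    {A : Matrix (Fin n) (Fin n) K} (hA : IsXMatrix A) : IsXMatrix A.charmatrix := by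
  intro i j h h'
  rw [charmatrix_apply_ne _ _ _ h, hA i j h h']
  simp

lemma det_xBlock_charmatrix {n : ℕ} {K : Type*} [Field K]
    (A : Matrix (Fin n) (Fin n) K) (i : Fin (n / 2)) :
    (xBlock A.charmatrix i).det = (X - C (A (lowEmb n i) (lowEmb n i))) *
          (X - C (A (lowEmb n i).rev (lowEmb n i).rev)) -
        C (A (lowEmb n i) (lowEmb n i).rev * A (lowEmb n i).rev (lowEmb n i)) := by
  have h : lowEmb n i ≠ (lowEmb n i).rev := by
    intro h
    have h' := congrArg Fin.val h
    have hi := i.2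
    rw [Fin.val_rev] at h'
    simp only [lowEmb, Fin.val_castLE] at h'
    omega
  rw [xBlock, det_fin_two_of, charmatrix_apply_eq, charmatrix_apply_eq,
    charmatrix_apply_ne _ _ _ h, charmatrix_apply_ne _ _ _ h.symm, C_mul]
  ring

/-- The characteristic polynomial `χ_A(t) = det (t I - A)` of an X-matrix factors as a
product of the quadratic polynomials
`(t - a_{i,i})(t - a_{n-i+1,n-i+1}) - a_{i,n-i+1} a_{n-i+1,i}` (times the linear factor
`t - a_{(n+1)/2,(n+1)/2}` when `n` is odd). -/
theorem charpoly_xMatrix {n : ℕ} {K : Type*} [Field K]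
    (A : Matrix (Fin n) (Fin n) K) (hA : IsXMatrix A) :
    (Even n → A.charpoly = ∏ i : Fin (n / 2),
      ((X - C (A (lowEmb n i) (lowEmb n i))) *
          (X - C (A (lowEmb n i).rev (lowEmb n i).rev)) -
        C (A (lowEmb n i) (lowEmb n i).rev * A (lowEmb n i).rev (lowEmb n i)))) ∧
    (∀ h : Odd n, A.charpoly =
      (X - C (A ⟨n / 2, by rcases h with ⟨k, rfl⟩; omega⟩
        ⟨n / 2, by rcases h with ⟨k, rfl⟩; omega⟩)) *
      ∏ i : Fin (n / 2),
        ((X - C (A (lowEmb n i) (lowEmb n i))) *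
            (X - C (A (lowEmb n i).rev (lowEmb n i).rev)) -
          C (A (lowEmb n i) (lowEmb n i).rev * A (lowEmb n i).rev (lowEmb n i)))) := by
  constructor
  · intro hn
    simp only [← det_xBlock_charmatrix]
    exact det_xMatrix_even hn _ hA.charmatrix
  · intro hn
    simp only [← det_xBlock_charmatrix]
    rw [← charmatrix_apply_eq]
    exact det_xMatrix_odd hn _ rfl _ hA.charmatrix
end
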